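/- Let K be a finite field with q^n elements, let d be a positive divisor of n with q^d > 2, and let α ∈ K be nonzero such that the polynomial X^{q^d} − α·X has q^d distinct roots, all lying in K. Then |W(X^{q^d} − α·X | K)| = q^{d·2^{n/d}}. -/

import Mathlib

open Polynomial

section
variable {F K : Type*} [Field F] [Fintype F] [Field K] [Finite K] [Algebra F K]

theorem apply_perm_pow {ι : Type*} (σ : Equiv.Perm ι) {c : ι → K}
    (hc : ∀ i, c (σ i) = c i ^ Fintype.card F) (t : ℕ) (i : ι) :
    c ((σ ^ t) i) = (FiniteField.frobeniusAlgEquivOfAlgebraic F K ^ t) (c i) := by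
  induction t with
  | zero => simp
  | succ t ih =>
    rw [pow_succ', pow_succ', Equiv.Perm.mul_apply, hc, ih, AlgEquiv.mul_apply,
      FiniteField.coe_frobeniusAlgEquivOfAlgebraic]

omit [Fintype F] in
theorem repr_normalBasis_apply (g h : Gal(K/F)) (x : K) :
    (IsGalois.normalBasis F K).repr (g x) (g * h) = (IsGalois.normalBasis F K).repr x h := by
  classical
  conv_lhs => rw [← (IsGalois.normalBasis F K).sum_repr x]
  have (e : Gal(K/F)) : g (IsGalois.normalBasis F K e) = IsGalois.normalBasis F K (g * e) := by
    rw [IsGalois.normalBasis_apply, IsGalois.normalBasis_apply (g * e), AlgEquiv.mul_apply]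
  simp only [map_sum, map_smul, this, Module.Basis.repr_self, Finsupp.coe_finsetSum,
    Finset.sum_apply, Finsupp.smul_apply, Finsupp.single_apply, mul_right_inj, smul_eq_mul]
  simp

theorem card_frobenius_equivariant {ι : Type*} [Fintype ι] (σ : Equiv.Perm ι)
    (hσ : σ ^ Module.finrank F K = 1) :
    Nat.card {c : ι → K // ∀ i, c (σ i) = c i ^ Fintype.card F} =
      Fintype.card F ^ Fintype.card ι := by
  classical
  set φ := FiniteField.frobeniusAlgEquivOfAlgebraic F K with hφ
  set b := IsGalois.normalBasis F K with hb
  have hord : orderOf φ = Module.finrank F K :=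
    FiniteField.orderOf_frobeniusAlgEquivOfAlgebraic F K
  rw [← Fintype.card_fun, ← Nat.card_eq_fintype_card (α := ι → F)]
  refine Nat.card_congr (Equiv.ofBijective
    (fun (c : {c : ι → K // ∀ i, c (σ i) = c i ^ Fintype.card F})
    (i : ι) => b.repr (c.1 i) 1) ⟨?_, ?_⟩)
  · rintro ⟨c, hc⟩ ⟨c', hc'⟩ h
    ext i
    apply b.repr.injective
    ext g
    obtain ⟨t, ht⟩ := (FiniteField.bijective_frobeniusAlgEquivOfAlgebraic_pow F K).2 g⁻¹
    have h1 := congrFun h ((σ ^ t.1) i)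
    simp only [apply_perm_pow (F := F) σ hc, apply_perm_pow (F := F) σ hc'] at h1
    have ht' : FiniteField.frobeniusAlgEquivOfAlgebraic F K ^ t.1 = g⁻¹ := ht
    rw [ht', ← inv_mul_cancel g, hb, repr_normalBasis_apply, repr_normalBasis_apply] at h1
    exact h1
  · intro a
    let u : ι → ℕ → K := fun i t => a ((σ ^ t) i) • b (φ⁻¹ ^ t)
    have hu (i : ι) (t : ℕ) : u (σ i) t = φ (u i (t + 1)) := by
      simp only [u, map_smul]
      rw [hb, IsGalois.normalBasis_apply (φ⁻¹ ^ t), IsGalois.normalBasis_apply (φ⁻¹ ^ (t + 1)),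
        ← AlgEquiv.mul_apply, pow_succ' φ⁻¹, mul_inv_cancel_left, pow_succ σ,
        Equiv.Perm.mul_apply]
    have hu0 (i : ι) : u i (Module.finrank F K) = u i 0 := by
      have h1 : φ ^ Module.finrank F K = 1 := by rw [← hord, pow_orderOf_eq_one]
      simp [u, hσ, h1]
    refine ⟨⟨fun i => ∑ t ∈ Finset.range (Module.finrank F K), u i t, fun i => ?_⟩, ?_⟩
    · have : (∑ t ∈ Finset.range (Module.finrank F K), u i t) ^ Fintype.card F =
        φ (∑ t ∈ Finset.range (Module.finrank F K), u i t) := rfl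
      rw [this]
      simp only [hu, ← map_sum]
      congr 1
      have h1 := Finset.sum_range_succ (u i) (Module.finrank F K)
      rw [Finset.sum_range_succ', hu0] at h1
      exact add_right_cancel h1
    · ext i
      simp only [u, map_sum, map_smul, Finsupp.coe_finsetSum, Finset.sum_apply,
        Module.Basis.repr_self, Finsupp.smul_apply, Finsupp.single_apply, smul_eq_mul]
      rw [Finset.sum_eq_single_of_mem 0 (by simpa using Module.finrank_pos)]
      · simp
      · intro t ht h0
        rw [if_neg, mul_zero]
        rw [inv_pow, inv_eq_one]
        exact pow_ne_one_of_lt_orderOf h0 (by rw [hord]; simpa using ht)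
end

section
variable {k : ℕ}

/-- The natural number with base-`Q` digits in `{0, 1}` prescribed by `s`. -/
def binaryDigitSum (Q : ℕ) {t : ℕ} (s : Fin t → Bool) : ℕ := ∑ i, (s i).toNat * Q ^ (i : ℕ)

/-- Cyclic shift of Boolean vectors. -/
def cyclicShift (t : ℕ) : Equiv.Perm (Fin t → Bool) :=
  (finRotate t).arrowCongr (Equiv.refl Bool)

theorem cyclicShift_pow (k : ℕ) : cyclicShift (k + 1) ^ (k + 1) = 1 := by
  have h (t : ℕ) (s : Fin (k + 1) → Bool) (i : Fin (k + 1)) :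
      (cyclicShift (k + 1) ^ t) s i = s (i - t • 1) := by
    induction t generalizing i with
    | zero => simp
    | succ t ih =>
      rw [pow_succ', Equiv.Perm.mul_apply]
      change ((cyclicShift (k + 1) ^ t) s) ((finRotate (k + 1)).symm i) = _
      rw [ih, finRotate_symm_apply, succ_nsmul]
      congr 1
      abel
  ext s i
  rw [h]
  have : (k + 1 : ℕ) • (1 : Fin (k + 1)) = 0 := by
    simpa using card_nsmul_eq_zero (x := (1 : Fin (k + 1)))
  simp [this]

theorem binaryDigitSum_cons (Q : ℕ) {t : ℕ} (b : Bool) (s : Fin t → Bool) :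
    binaryDigitSum Q (Fin.cons b s : Fin (t + 1) → Bool) = b.toNat + Q * binaryDigitSum Q s := by
  simp only [binaryDigitSum, Fin.sum_univ_succ, Fin.cons_zero, Fin.cons_succ, Finset.mul_sum,
    Fin.val_zero, pow_zero, mul_one, Fin.val_succ]
  congr 1
  exact Finset.sum_congr rfl fun i _ => by ring

theorem binaryDigitSum_cyclicShift (Q : ℕ) (s : Fin (k + 1) → Bool) :
    binaryDigitSum Q (cyclicShift (k + 1) s) =
      (s (Fin.last k)).toNat + Q * binaryDigitSum Q (Fin.init s) := by
  rw [← binaryDigitSum_cons]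
  congr 1
  ext i
  change s ((finRotate (k + 1)).symm i) = _
  refine Fin.cases ?_ (fun j => ?_) i
  · rw [Fin.cons_zero, ← finRotate_last, Equiv.symm_apply_apply]
  · rw [Fin.cons_succ, Fin.init]
    congr 1
    rw [Equiv.symm_apply_eq, finRotate_apply]
    simp

theorem binaryDigitSum_last (Q : ℕ) (s : Fin (k + 1) → Bool) :
    binaryDigitSum Q s = binaryDigitSum Q (Fin.init s) + (s (Fin.last k)).toNat * Q ^ k := by
  simp [binaryDigitSum, Fin.sum_univ_castSucc, Fin.init]

theorem binaryDigitSum_injective {Q : ℕ} (hQ : 1 < Q) (t : ℕ) :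
    Function.Injective (binaryDigitSum Q : (Fin t → Bool) → ℕ) := by
  induction t with
  | zero => exact Function.injective_of_subsingleton _
  | succ t ih =>
    intro s s' h
    rw [← Fin.cons_self_tail s, ← Fin.cons_self_tail s'] at h ⊢
    rw [binaryDigitSum_cons, binaryDigitSum_cons] at h
    have hb (b : Bool) : b.toNat < Q := by cases b <;> simp <;> omega
    have h1 := congrArg (· % Q) h
    have h2 := congrArg (· / Q) h
    simp only [Nat.add_mul_mod_self_left, Nat.mod_eq_of_lt (hb _)] at h1
    simp only [Nat.add_mul_div_left _ _ (show 0 < Q by omega), Nat.div_eq_of_lt (hb _),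
      zero_add] at h2
    rw [ih h2, show s 0 = s' 0 by revert h1; cases s 0 <;> cases s' 0 <;> simp]

theorem binaryDigitSum_lt {Q : ℕ} (hQ : 1 < Q) {t : ℕ} (s : Fin t → Bool) :
    binaryDigitSum Q s < Q ^ t := by
  induction t with
  | zero => simp [binaryDigitSum]
  | succ t ih =>
    rw [← Fin.cons_self_tail s, binaryDigitSum_cons, pow_succ']
    have := ih (Fin.tail s)
    have hb : (s 0).toNat < Q := by cases s 0 <;> simp <;> omega
    nlinarith
end

section
variable {F K : Type*} [Field F] [Fintype F] [Field K] [Algebra F K]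

theorem natCast_card_eq_zero_of_algebra : (Fintype.card F : K) = 0 := by
  rw [← map_natCast (algebraMap F K), FiniteField.cast_card_eq_zero, map_zero]

theorem pow_card_eq_expand_map (g : K[X]) :
    g ^ Fintype.card F =
      expand K (Fintype.card F) (g.map (FiniteField.frobeniusAlgHom F K : K →+* K)) := by
  have h : (FiniteField.frobeniusAlgHom F K[X] : K[X] →+* K[X]) =
      ((expand K (Fintype.card F) : K[X] →ₐ[K] K[X]) : K[X] →+* K[X]).comp
        (mapRingHom (FiniteField.frobeniusAlgHom F K : K →+* K)) :=
    ringHom_ext (by simp) (by simp)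
  simpa using! RingHom.congr_fun h g

theorem coeff_pow_card (g : K[X]) (j : ℕ) :
    (g ^ Fintype.card F).coeff j =
      if Fintype.card F ∣ j then g.coeff (j / Fintype.card F) ^ Fintype.card F else 0 := by
  rw [pow_card_eq_expand_map, coeff_expand Fintype.card_pos]
  simp

theorem coeff_X_mul_derivative (g : K[X]) (j : ℕ) :
    (X * derivative g).coeff j = j * g.coeff j := by
  cases j with
  | zero => simp
  | succ j => rw [coeff_X_mul, coeff_derivative]; push_cast; ring

/-- The polynomial with coefficient `c s` at the exponent `binaryDigitSum Q s`. -/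
noncomputable def ofBinaryCoeffs (Q : ℕ) {t : ℕ} (c : (Fin t → Bool) → K) : K[X] :=
  ∑ s, C (c s) * X ^ binaryDigitSum Q s

theorem coeff_ofBinaryCoeffs {Q : ℕ} (hQ : 1 < Q) {t : ℕ} (c : (Fin t → Bool) → K)
    (s : Fin t → Bool) : (ofBinaryCoeffs Q c).coeff (binaryDigitSum Q s) = c s := by
  simp [ofBinaryCoeffs, coeff_X_pow, (binaryDigitSum_injective hQ t).eq_iff]

theorem coeff_ofBinaryCoeffs_eq_zero {Q t : ℕ} (c : (Fin t → Bool) → K) {j : ℕ}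
    (hj : ∀ s : Fin t → Bool, j ≠ binaryDigitSum Q s) : (ofBinaryCoeffs Q c).coeff j = 0 := by
  simp [ofBinaryCoeffs, coeff_X_pow, hj]

theorem ofBinaryCoeffs_pow_card_sub {k : ℕ} (c : (Fin (k + 1) → Bool) → K)
    (hc : ∀ s, c (cyclicShift (k + 1) s) = c s ^ Fintype.card F) :
    ofBinaryCoeffs (Fintype.card F) c ^ Fintype.card F - ofBinaryCoeffs (Fintype.card F) c =
      (X ^ Fintype.card F ^ (k + 1) - X) *
        derivative (ofBinaryCoeffs (Fintype.card F) c) := by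
  have h1 : ofBinaryCoeffs (Fintype.card F) c ^ Fintype.card F =
      ∑ s, C (c (cyclicShift (k + 1) s)) *
        X ^ (Fintype.card F * binaryDigitSum (Fintype.card F) s) := by
    have := map_sum (FiniteField.frobeniusAlgHom F K[X])
      (fun s => C (c s) * X ^ binaryDigitSum (Fintype.card F) s) Finset.univ
    simp only [FiniteField.coe_frobeniusAlgHom] at this
    rw [ofBinaryCoeffs, this]
    refine Finset.sum_congr rfl fun s _ => ?_
    rw [hc, mul_pow, ← C_pow, ← pow_mul, mul_comm (binaryDigitSum _ _)]
  have h2 : ofBinaryCoeffs (Fintype.card F) c =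
      ∑ s, C (c (cyclicShift (k + 1) s)) *
        X ^ binaryDigitSum (Fintype.card F) (cyclicShift (k + 1) s) :=
    (Equiv.sum_comp (cyclicShift (k + 1))
      fun s => C (c s) * X ^ binaryDigitSum (Fintype.card F) s).symm
  rw [h1, h2, derivative_sum, Finset.mul_sum, ← Finset.sum_sub_distrib]
  refine Finset.sum_congr rfl fun s _ => ?_
  rw [binaryDigitSum_cyclicShift, binaryDigitSum_last]
  have hz : (Fintype.card F : K) = 0 := natCast_card_eq_zero_of_algebra
  cases s (Fin.last k)
  · simp [hz, derivative_X_pow]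
  · simp only [Bool.toNat_true, one_mul, derivative_C_mul, derivative_X_pow, Nat.cast_add,
      Nat.cast_one, Nat.cast_mul, hz, zero_mul, add_zero, map_one, add_tsub_cancel_left]
    ring

end

section
variable {F K : Type*} [Field F] [Fintype F] [Field K] [Algebra F K] {k : ℕ} {θ : K} {g : K[X]}

omit [Algebra F K] in
theorem natDegree_lt_of_pow_card_sub (hF : 2 < Fintype.card F)
    (h : g ^ Fintype.card F - g =
      C θ * ((X ^ Fintype.card F ^ (k + 1) - X) * derivative g)) :
    g.natDegree < Fintype.card F ^ (k + 1) := by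
  rcases Nat.eq_zero_or_pos g.natDegree with h0 | h0
  · rw [h0]; positivity
  have h1 : (g ^ Fintype.card F - g).natDegree = Fintype.card F * g.natDegree := by
    rw [natDegree_sub_eq_left_of_natDegree_lt, natDegree_pow]
    rw [natDegree_pow]
    nlinarith
  have h2 := congrArg natDegree h
  rw [h1] at h2
  have h3 : (C θ * ((X ^ Fintype.card F ^ (k + 1) - X) * derivative g)).natDegree ≤
      Fintype.card F ^ (k + 1) + (g.natDegree - 1) := by
    refine (natDegree_C_mul_le _ _).trans (natDegree_mul_le.trans ?_)
    refine add_le_add ((natDegree_sub_le _ _).trans ?_) (natDegree_derivative_le g)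
    simpa using Nat.one_le_pow _ _ Fintype.card_pos
  have : 3 * g.natDegree ≤ Fintype.card F * g.natDegree := by gcongr; omega
  omega

variable (hdeg : g.natDegree < Fintype.card F ^ (k + 1))
  (h : g ^ Fintype.card F - g = C θ * ((X ^ Fintype.card F ^ (k + 1) - X) * derivative g))

include h

theorem coeff_eq_of_lt {j : ℕ} (hj : j < Fintype.card F ^ (k + 1)) :
    (if Fintype.card F ∣ j then g.coeff (j / Fintype.card F) ^ Fintype.card F else 0) =
      (1 - θ * j) * g.coeff j := by
  have h1 := congrArg (coeff · j) h
  simp only [coeff_sub, coeff_pow_card, coeff_C_mul, sub_mul, coeff_X_mul_derivative,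
    coeff_X_pow_mul', if_neg hj.not_ge] at h1
  linear_combination h1

theorem coeff_pow_eq_coeff_mul {j : ℕ} (hj : Fintype.card F * j < Fintype.card F ^ (k + 1)) :
    g.coeff j ^ Fintype.card F = g.coeff (Fintype.card F * j) := by
  have hz : (Fintype.card F : K) = 0 := natCast_card_eq_zero_of_algebra
  have := coeff_eq_of_lt h hj
  simpa [hz, Nat.mul_div_cancel_left _ (Fintype.card_pos (α := F))] using this

include hdeg

theorem coeff_card_pow_add (i : ℕ) :
    (if Fintype.card F ∣ i then
      g.coeff (Fintype.card F ^ k + i / Fintype.card F) ^ Fintype.card F else 0) =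
      θ * ((i + 1) * g.coeff (i + 1)) := by
  have h1 := congrArg (coeff · (Fintype.card F ^ (k + 1) + i)) h
  have h0 : g.coeff (Fintype.card F ^ (k + 1) + i) = 0 :=
    coeff_eq_zero_of_natDegree_lt (by omega)
  have hd : Fintype.card F ∣ Fintype.card F ^ (k + 1) + i ↔ Fintype.card F ∣ i :=
    Nat.dvd_add_right (dvd_pow_self _ k.succ_ne_zero)
  have hq : (Fintype.card F ^ (k + 1) + i) / Fintype.card F =
      Fintype.card F ^ k + i / Fintype.card F := by
    rw [pow_succ', Nat.mul_add_div Fintype.card_pos]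
  simp only [coeff_sub, coeff_pow_card, coeff_C_mul, sub_mul, coeff_X_mul_derivative,
    h0, hd, hq, mul_zero, sub_zero, coeff_X_pow_mul', le_add_iff_nonneg_right, zero_le, if_true,
    add_tsub_cancel_left, coeff_derivative] at h1
  rw [h1]
  ring

theorem coeff_card_pow_add_pow (r : ℕ) :
    g.coeff (Fintype.card F ^ k + r) ^ Fintype.card F =
      θ * g.coeff (Fintype.card F * r + 1) := by
  have hz : (Fintype.card F : K) = 0 := natCast_card_eq_zero_of_algebra
  simpa [hz, Nat.mul_div_cancel_left _ (Fintype.card_pos (α := F))] using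
    coeff_card_pow_add hdeg h (Fintype.card F * r)

theorem exists_eq_card_mul_add_one {j : ℕ} (hj : g.coeff j ≠ 0)
    (hdvd : ¬ Fintype.card F ∣ j) : θ * j = 1 ∧ ∃ r, j = Fintype.card F * r + 1 := by
  have hlt : j < Fintype.card F ^ (k + 1) := (le_natDegree_of_ne_zero hj).trans_lt hdeg
  have h1 := coeff_eq_of_lt h hlt
  rw [if_neg hdvd, eq_comm, mul_eq_zero, or_iff_left hj, sub_eq_zero, eq_comm] at h1
  refine ⟨h1, ?_⟩
  cases j with
  | zero => simp at hdvd
  | succ i =>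
    by_cases hi : Fintype.card F ∣ i
    · obtain ⟨r, rfl⟩ := hi
      exact ⟨r, rfl⟩
    · have h2 := coeff_card_pow_add hdeg h i
      rw [if_neg hi] at h2
      push_cast at h1
      have : g.coeff (i + 1) = 0 := by linear_combination -h2 - g.coeff (i + 1) * h1
      exact absurd this hj

theorem eq_one_or_natDegree_eq_zero : θ = 1 ∨ g.natDegree = 0 := by
  have hz : (Fintype.card F : K) = 0 := natCast_card_eq_zero_of_algebra
  have key : ∀ j, 0 < j → g.coeff j ≠ 0 → θ = 1 := by
    intro j
    induction j using Nat.strong_induction_on with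
    | _ j ih =>
      intro h0 hj
      by_cases hdvd : Fintype.card F ∣ j
      · obtain ⟨r, rfl⟩ := hdvd
        have hlt := (le_natDegree_of_ne_zero hj).trans_lt hdeg
        have hr : 0 < r := Nat.pos_of_mul_pos_left h0
        have hF : 1 < Fintype.card F := Fintype.one_lt_card
        refine ih r (by nlinarith) hr fun hr0 => hj ?_
        rw [← coeff_pow_eq_coeff_mul h hlt, hr0, zero_pow Fintype.card_ne_zero]
      · obtain ⟨h1, r, rfl⟩ := exists_eq_card_mul_add_one hdeg h hj hdvd
        simpa [hz] using h1
  by_cases h0 : g.natDegree = 0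
  · exact .inr h0
  · refine .inl (key _ (Nat.pos_of_ne_zero h0) ?_)
    rw [coeff_natDegree, leadingCoeff_ne_zero]
    rintro rfl
    simp at h0

end

section
variable {F K : Type*} [Field F] [Fintype F] [Field K] [Algebra F K] {k : ℕ} {g : K[X]}
variable (hdeg : g.natDegree < Fintype.card F ^ (k + 1))
  (h : g ^ Fintype.card F - g = C 1 * ((X ^ Fintype.card F ^ (k + 1) - X) * derivative g))
include hdeg h

theorem exists_mod_eq_binaryDigitSum {t : ℕ} (ht : t ≤ k + 1) {j : ℕ} (hj : g.coeff j ≠ 0) :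
    ∃ s : Fin t → Bool, j % Fintype.card F ^ t = binaryDigitSum (Fintype.card F) s := by
  induction t generalizing j with
  | zero => exact ⟨Fin.elim0, by simp [binaryDigitSum, Nat.mod_one]⟩
  | succ t ih =>
    have hF : 1 < Fintype.card F := Fintype.one_lt_card
    by_cases hdvd : Fintype.card F ∣ j
    · obtain ⟨r, rfl⟩ := hdvd
      have hlt := (le_natDegree_of_ne_zero hj).trans_lt hdeg
      rw [← coeff_pow_eq_coeff_mul h hlt] at hj
      obtain ⟨s, hs⟩ := ih (by omega) (ne_zero_pow Fintype.card_ne_zero hj)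
      refine ⟨Fin.cons false s, ?_⟩
      rw [binaryDigitSum_cons, ← hs, pow_succ', Nat.mul_mod_mul_left]
      simp
    · obtain ⟨-, r, rfl⟩ := exists_eq_card_mul_add_one hdeg h hj hdvd
      have hr := coeff_card_pow_add_pow hdeg h r
      rw [one_mul] at hr
      rw [← hr] at hj
      obtain ⟨s, hs⟩ := ih (by omega) (ne_zero_pow Fintype.card_ne_zero hj)
      refine ⟨Fin.cons true s, ?_⟩
      obtain ⟨e, he⟩ := pow_dvd_pow (Fintype.card F) (show t ≤ k by omega)
      rw [he, Nat.mul_add_mod] at hs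
      rw [binaryDigitSum_cons, ← hs, pow_succ', Nat.mod_mul, Nat.mul_add_mod,
        Nat.mod_eq_of_lt hF, Nat.mul_add_div Fintype.card_pos, Nat.div_eq_of_lt hF]
      simp

theorem ofBinaryCoeffs_coeff :
    ofBinaryCoeffs (Fintype.card F)
      (fun s : Fin (k + 1) → Bool => g.coeff (binaryDigitSum (Fintype.card F) s)) = g := by
  ext j
  by_cases hs : ∃ s : Fin (k + 1) → Bool, j = binaryDigitSum (Fintype.card F) s
  · obtain ⟨s, rfl⟩ := hs
    rw [coeff_ofBinaryCoeffs Fintype.one_lt_card]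
  · rw [coeff_ofBinaryCoeffs_eq_zero _ (not_exists.1 hs)]
    by_contra hj
    obtain ⟨s, hs'⟩ := exists_mod_eq_binaryDigitSum hdeg h le_rfl (Ne.symm hj)
    rw [Nat.mod_eq_of_lt ((le_natDegree_of_ne_zero (Ne.symm hj)).trans_lt hdeg)] at hs'
    exact hs ⟨s, hs'⟩

theorem coeff_binaryDigitSum_cyclicShift (s : Fin (k + 1) → Bool) :
    g.coeff (binaryDigitSum (Fintype.card F) (cyclicShift (k + 1) s)) =
      g.coeff (binaryDigitSum (Fintype.card F) s) ^ Fintype.card F := by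
  have hlt := binaryDigitSum_lt (Fintype.one_lt_card (α := F)) (cyclicShift (k + 1) s)
  rw [binaryDigitSum_cyclicShift] at hlt ⊢
  rw [binaryDigitSum_last]
  cases hs : s (Fin.last k)
  · rw [hs] at hlt
    simp only [Bool.toNat_false, zero_add, zero_mul, add_zero] at hlt ⊢
    exact (coeff_pow_eq_coeff_mul h hlt).symm
  · simp only [Bool.toNat_true, one_mul]
    rw [add_comm _ (_ ^ k), coeff_card_pow_add_pow hdeg h, one_mul, add_comm]

end

theorem ncard_pow_card_sub {F K : Type*} [Field F] [Fintype F] [Field K] [Finite K] [Algebra F K]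
    (hF : 2 < Fintype.card F) {m : ℕ} (hm : Module.finrank F K = m) :
    {g : K[X] | ∃ θ : K, θ ≠ 0 ∧ g ^ Fintype.card F - g =
      C θ * ((X ^ Fintype.card F ^ m - X) * derivative g)}.ncard =
      Fintype.card F ^ 2 ^ m := by
  obtain ⟨k, rfl⟩ : ∃ k, m = k + 1 :=
    Nat.exists_eq_succ_of_ne_zero (hm ▸ Module.finrank_pos.ne')
  have hcard := card_frobenius_equivariant (F := F) (K := K) (cyclicShift (k + 1))
    (by rw [hm, cyclicShift_pow])
  rw [Fintype.card_fun, Fintype.card_bool, Fintype.card_fin] at hcard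
  rw [← hcard]
  have hinj : Function.Injective
      (ofBinaryCoeffs (Fintype.card F) : ((Fin (k + 1) → Bool) → K) → K[X]) := by
    intro c c' h
    ext s
    rw [← coeff_ofBinaryCoeffs (Fintype.one_lt_card (α := F)) c, h,
      coeff_ofBinaryCoeffs Fintype.one_lt_card c']
  change _ = Nat.card ({c : (Fin (k + 1) → Bool) → K |
    ∀ s, c (cyclicShift (k + 1) s) = c s ^ Fintype.card F} : Set _)
  rw [Nat.card_coe_set_eq, ← Set.ncard_image_of_injective _ hinj]
  congr 1
  ext g
  constructor
  · rintro ⟨θ, -, h⟩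
    have hdeg := natDegree_lt_of_pow_card_sub hF h
    have h1 : g ^ Fintype.card F - g =
        C 1 * ((X ^ Fintype.card F ^ (k + 1) - X) * derivative g) := by
      rcases eq_one_or_natDegree_eq_zero hdeg h with rfl | h0
      · exact h
      · rw [h, derivative_of_natDegree_zero h0, mul_zero, mul_zero, mul_zero]
    exact ⟨fun s => g.coeff (binaryDigitSum (Fintype.card F) s),
      coeff_binaryDigitSum_cyclicShift hdeg h1, ofBinaryCoeffs_coeff hdeg h1⟩
  · rintro ⟨c, hc, rfl⟩
    exact ⟨1, one_ne_zero, by rw [ofBinaryCoeffs_pow_card_sub c hc, C_1, one_mul]⟩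

theorem exists_ne_zero_pow_eq_mul {K : Type*} [Field K] {Q : ℕ} {α : K} (hQ : 1 < Q)
    (hsplit : Multiset.card (X ^ Q - C α * X : K[X]).roots = Q)
    (hsep : (X ^ Q - C α * X : K[X]).roots.Nodup) : ∃ β : K, β ≠ 0 ∧ β ^ Q = α * β := by
  classical
  have hcard : 1 < (X ^ Q - C α * X : K[X]).roots.toFinset.card := by
    rw [Multiset.toFinset_card_of_nodup hsep, hsplit]
    exact hQ
  obtain ⟨β, hβ, h0⟩ := Finset.exists_mem_ne hcard 0
  rw [Multiset.mem_toFinset] at hβ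
  have h1 := (mem_roots'.1 hβ).2
  simp only [IsRoot.def, eval_sub, eval_pow, eval_X, eval_mul, eval_C] at h1
  exact ⟨β, h0, sub_eq_zero.1 h1⟩

theorem ncard_comp_eq_ncard_pow_sub {K : Type*} [Field K] {Q N : ℕ} {α β : K} (hα : α ≠ 0)
    (hβ : β ≠ 0) (h : β ^ Q = α * β) :
    {f : K[X] | ∃ θ : K, θ ≠ 0 ∧ (X ^ Q - C α * X : K[X]).comp f =
      C θ * ((X ^ N - X) * f.derivative)}.ncard =
    {g : K[X] | ∃ θ : K, θ ≠ 0 ∧ g ^ Q - g = C θ * ((X ^ N - X) * derivative g)}.ncard := by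
  have hCβ : (C β : K[X]) ≠ 0 := C_ne_zero.2 hβ
  have hCα : (C α : K[X]) ≠ 0 := C_ne_zero.2 hα
  have hC : (C β : K[X]) ^ Q = C α * C β := by rw [← C_pow, h, C_mul]
  symm
  rw [← Set.ncard_image_of_injective _ (mul_right_injective₀ hCβ)]
  congr 1
  have hsurj (f : K[X]) : ∃ g, C β * g = f :=
    ⟨C β⁻¹ * f, by rw [← mul_assoc, ← C_mul, mul_inv_cancel₀ hβ, C_1, one_mul]⟩
  have hcomp (g : K[X]) : (X ^ Q - C α * X : K[X]).comp (C β * g) =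
      C α * C β * (g ^ Q - g) := by
    simp only [sub_comp, pow_comp, X_comp, mul_comp, C_comp, mul_pow, hC]
    ring
  ext f
  obtain ⟨g, rfl⟩ := hsurj f
  rw [(mul_right_injective₀ hCβ).mem_set_image]
  simp only [Set.mem_ofPred_eq, hcomp, derivative_C_mul]
  constructor
  · rintro ⟨θ, hθ, h⟩
    refine ⟨α * θ, mul_ne_zero hα hθ, ?_⟩
    rw [h, C_mul]
    ring
  · rintro ⟨θ, hθ, h⟩
    refine ⟨α⁻¹ * θ, mul_ne_zero (inv_ne_zero hα) hθ, mul_left_cancel₀ (mul_ne_zero hCα hCβ) ?_⟩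
    rw [h, C_mul]
    have : (C α : K[X]) * C α⁻¹ = 1 := by rw [← C_mul, mul_inv_cancel₀ hα, C_1]
    linear_combination (-C β * C θ * (X ^ N - X) * derivative g) * this

theorem exists_field_card_eq {q n d : ℕ} (hq : IsPrimePow q) (hd : 0 < d) (hdn : d ∣ n)
    {K : Type*} [Field K] [Fintype K] (hK : Fintype.card K = q ^ n) :
    ∃ (F : Type) (_ : Field F) (_ : Fintype F) (_ : Algebra F K),
      Fintype.card F = q ^ d ∧ Module.finrank F K = n / d := by
  obtain ⟨p, e, hp, he, rfl⟩ := (isPrimePow_nat_iff _).1 hq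
  have : Fact p.Prime := ⟨hp⟩
  rw [← pow_mul] at hK
  have hchar : CharP K p := charP_of_card_eq_prime_pow hK
  let := ZMod.algebra K p
  have hfin : Module.finrank (ZMod p) K = e * n := by
    have h1 := Module.card_eq_pow_finrank (K := ZMod p) (V := K)
    rw [hK, ZMod.card] at h1
    exact (Nat.pow_right_injective hp.two_le h1).symm
  have hed : e * d ≠ 0 := by positivity
  obtain ⟨φ⟩ := FiniteField.nonempty_algHom_of_finrank_dvd (F := ZMod p)
    (K := GaloisField p (e * d)) (L := K)
    (by rw [hfin, GaloisField.finrank p hed]; exact Nat.mul_dvd_mul_left e hdn)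
  let := (φ : GaloisField p (e * d) →+* K).toAlgebra
  let := Fintype.ofFinite (GaloisField p (e * d))
  have hF : Fintype.card (GaloisField p (e * d)) = p ^ (e * d) := by
    rw [← Nat.card_eq_fintype_card, GaloisField.card p _ hed]
  refine ⟨GaloisField p (e * d), inferInstance, inferInstance, inferInstance,
    by rw [hF, pow_mul], ?_⟩
  have h1 := Module.card_eq_pow_finrank (K := GaloisField p (e * d)) (V := K)
  rw [hK, hF, ← pow_mul] at h1
  have h2 := Nat.pow_right_injective hp.two_le h1
  rw [mul_assoc] at h2
  rw [Nat.eq_of_mul_eq_mul_left he h2, Nat.mul_div_cancel_left _ hd]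

/-- Let `K` have `q^n` elements, `d` a positive divisor of `n` with
`q^d > 2`, and `α ≠ 0` with `X^{q^d} − αX` having `q^d` distinct roots in `K`. Then
`|W(X^{q^d} − αX | K)| = q^{d·2^{n/d}}`. -/
theorem stmt14 (q n d : ℕ) (hq : IsPrimePow q) (hn : 1 ≤ n) (hd : 0 < d)
    (hdn : d ∣ n) (hqd : 2 < q ^ d)
    {K : Type*} [Field K] [Fintype K] (hK : Fintype.card K = q ^ n)
    (α : K) (hα : α ≠ 0)
    (hsplit : Multiset.card (X ^ q ^ d - C α * X : K[X]).roots = q ^ d)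
    (hsep : (X ^ q ^ d - C α * X : K[X]).roots.Nodup) :
    {f : K[X] | ∃ θ : K, θ ≠ 0 ∧
      (X ^ q ^ d - C α * X : K[X]).comp f =
        C θ * ((X ^ q ^ n - X) * f.derivative)}.ncard = q ^ (d * 2 ^ (n / d)) := by
  obtain ⟨β, hβ, h⟩ := exists_ne_zero_pow_eq_mul (by omega) hsplit hsep
  obtain ⟨F, _, _, _, hF, hrank⟩ := exists_field_card_eq hq hd hdn hK
  have key := ncard_pow_card_sub (F := F) (K := K) (by rwa [hF]) hrank
  rw [hF, ← pow_mul, ← pow_mul, Nat.mul_div_cancel' hdn] at key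
  rw [ncard_comp_eq_ncard_pow_sub hα hβ h, key]
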